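/- Let $(D, \nu)$ be a probability space and let $\eta_1, \dots, \eta_m : D \to \mathbb{C}$ be measurable functions that are orthonormal in $L_2(D, \nu)$. Define the density $\varphi(x) := \frac{1}{2} + \frac{1}{2m} \sum_{k=1}^m |\eta_k(x)|^2$ and the probability measure $d\mu := \varphi\, d\nu$ on $D$. Let $p, t \in (0,1)$ and $M \in \mathbb{N}$ with $M \ge \frac{4}{t^2} m \log(\frac{m}{p})$, and draw nodes $\tilde{x}^1, \dots, \tilde{x}^M \in D$ i.i.d. according to $\mu$. Then with probability exceeding $1 - p$: for all $a \in \mathbb{C}^m$, $(1-t) \|a\|_2^2 \le \frac{1}{M} \sum_{i=1}^M \frac{|\sum_{k=1}^m a_k \eta_k(\tilde{x}^i)|^2}{\varphi(\tilde{x}^i)}$. -/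

import Mathlib

open MeasureTheory

section LieProduct

open Filter Topology
open NormedSpace (exp)

theorem norm_pow_sub_pow_le {R : Type*} [NormedRing R] [NormOneClass R] {x y : R} {K : ℝ}
    (hx : ‖x‖ ≤ K) (hy : ‖y‖ ≤ K) (n : ℕ) :
    ‖x ^ n - y ^ n‖ ≤ n * K ^ (n - 1) * ‖x - y‖ := by
  have hK : 0 ≤ K := (norm_nonneg x).trans hx
  induction n with
  | zero => simp
  | succ n ih =>
    have hsplit : x ^ (n + 1) - y ^ (n + 1) = x ^ n * (x - y) + (x ^ n - y ^ n) * y := by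
      rw [pow_succ, pow_succ]; noncomm_ring
    have hxn : ‖x ^ n‖ ≤ K ^ n := (norm_pow_le x n).trans (by gcongr)
    have hprev : ‖x ^ n - y ^ n‖ * K ≤ n * K ^ n * ‖x - y‖ := by
      rcases n with _ | n
      · simp
      · calc _ ≤ ((n + 1 : ℕ) * K ^ n * ‖x - y‖) * K := by gcongr; simpa using ih
          _ = _ := by ring
    calc ‖x ^ (n + 1) - y ^ (n + 1)‖
        ≤ ‖x ^ n‖ * ‖x - y‖ + ‖x ^ n - y ^ n‖ * ‖y‖ := by
          rw [hsplit]
          exact (norm_add_le _ _).trans (add_le_add (norm_mul_le _ _) (norm_mul_le _ _))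
      _ ≤ K ^ n * ‖x - y‖ + ‖x ^ n - y ^ n‖ * K := by gcongr
      _ ≤ K ^ n * ‖x - y‖ + n * K ^ n * ‖x - y‖ := by gcongr
      _ = _ := by rw [Nat.add_sub_cancel]; push_cast; ring

theorem norm_exp_le_exp_norm {R : Type*} [NormedRing R] [NormOneClass R] [NormedAlgebra ℝ R]
    [CompleteSpace R] (x : R) : ‖exp x‖ ≤ Real.exp ‖x‖ := by
  have h := NormedSpace.exp_series_hasSum_exp' (𝕂 := ℝ) ‖x‖
  rw [← Real.exp_eq_exp_ℝ] at h
  refine (NormedSpace.exp_series_hasSum_exp' (𝕂 := ℝ) x).norm_le_of_bounded h fun k => ?_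
  rw [norm_smul, smul_eq_mul, norm_inv, Real.norm_natCast]
  gcongr
  exact norm_pow_le x k

/-- The **Lie product formula**. -/
theorem tendsto_exp_mul_exp_pow {R : Type*} [NormedRing R] [NormOneClass R] [NormedAlgebra ℝ R]
    [CompleteSpace R] (a b : R) :
    Tendsto (fun n : ℕ => (exp ((n : ℝ)⁻¹ • a) * exp ((n : ℝ)⁻¹ • b)) ^ n) atTop
      (𝓝 (exp (a + b))) := by
  let _ : NormedAlgebra ℚ R := NormedAlgebra.restrictScalars ℚ ℝ R
  let f : ℝ → R := fun s => exp (s • a) * exp (s • b) - exp (s • (a + b))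
  have hf : HasDerivAt f 0 0 := by
    have := ((hasDerivAt_exp_smul_const a (0 : ℝ)).mul
      (hasDerivAt_exp_smul_const b (0 : ℝ))).sub (hasDerivAt_exp_smul_const (a + b) (0 : ℝ))
    simp only [zero_smul, NormedSpace.exp_zero, one_mul, mul_one, sub_self] at this
    exact this
  have hf0 : f 0 = 0 := by simp [f]
  have hinv : Tendsto (fun n : ℕ => (n : ℝ)⁻¹) atTop (𝓝[≠] 0) := by
    refine tendsto_nhdsWithin_iff.2 ⟨tendsto_inv_atTop_nhds_zero_nat, ?_⟩
    filter_upwards [eventually_gt_atTop 0] with n hn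
    simp; omega
  have hslope : Tendsto (fun n : ℕ => ‖(n : ℝ) • f ((n : ℝ)⁻¹)‖) atTop (𝓝 0) := by
    have := (hf.tendsto_slope_zero.comp hinv).norm
    simpa [Function.comp_def, hf0] using this
  have hpow : ∀ n : ℕ, 0 < n → exp ((n : ℝ)⁻¹ • (a + b)) ^ n = exp (a + b) := fun n hn => by
    rw [← NormedSpace.exp_nsmul, ← Nat.cast_smul_eq_nsmul ℝ, smul_smul,
      mul_inv_cancel₀ (by positivity), one_smul]
  rw [tendsto_iff_norm_sub_tendsto_zero]
  refine squeeze_zero' (g := fun n : ℕ => Real.exp (‖a‖ + ‖b‖) * ‖(n : ℝ) • f ((n : ℝ)⁻¹)‖)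
    (Eventually.of_forall fun _ => norm_nonneg _) ?_ (by simpa using hslope.const_mul _)
  filter_upwards [eventually_gt_atTop 0] with n hn
  have hn' : (0 : ℝ) < n := by exact_mod_cast hn
  set K := Real.exp ((n : ℝ)⁻¹ * (‖a‖ + ‖b‖)) with hK
  have hx : ‖exp ((n : ℝ)⁻¹ • a) * exp ((n : ℝ)⁻¹ • b)‖ ≤ K := by
    refine (norm_mul_le _ _).trans ?_
    rw [hK, mul_add, Real.exp_add]
    gcongr <;> exact (norm_exp_le_exp_norm _).trans (by rw [norm_smul]; simp)
  have hy : ‖exp ((n : ℝ)⁻¹ • (a + b))‖ ≤ K := by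
    refine (norm_exp_le_exp_norm _).trans ?_
    rw [hK, norm_smul]
    gcongr
    · simp
    · exact norm_add_le _ _
  have hKn : K ^ (n - 1) ≤ Real.exp (‖a‖ + ‖b‖) := by
    calc K ^ (n - 1) ≤ K ^ n :=
          pow_le_pow_right₀ (Real.one_le_exp (by positivity)) (Nat.sub_le _ _)
      _ = _ := by rw [hK, ← Real.exp_nat_mul]; congr 1; field_simp
  rw [← hpow n hn]
  refine (norm_pow_sub_pow_le hx hy n).trans ?_
  rw [norm_smul, Real.norm_natCast]
  calc _ ≤ (n : ℝ) * Real.exp (‖a‖ + ‖b‖) * ‖f ((n : ℝ)⁻¹)‖ := by gcongr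
    _ = _ := by ring

end LieProduct

namespace Matrix

open Filter Topology
open NormedSpace (exp)
open scoped ComplexOrder

variable {n : Type*}

theorem IsHermitian.real_smul {X : Matrix n n ℂ} (hX : X.IsHermitian) (c : ℝ) :
    (c • X).IsHermitian := by
  simp [IsHermitian, conjTranspose_smul, hX.eq]

variable [Fintype n]

theorem re_trace_mul_conjTranspose_self (X : Matrix n n ℂ) :
    (X * Xᴴ).trace.re = ∑ i, ∑ j, ‖X i j‖ ^ 2 := by
  simp only [Matrix.trace, diag_apply, Matrix.mul_apply, conjTranspose_apply, RCLike.star_def,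
    Complex.mul_conj, Complex.normSq_eq_norm_sq, Complex.re_sum, Complex.ofReal_re]

theorem norm_trace_mul_le (Y Z : Matrix n n ℂ) :
    ‖(Y * Z).trace‖ ≤ ((Y * Yᴴ).trace.re + (Z * Zᴴ).trace.re) / 2 := by
  rw [re_trace_mul_conjTranspose_self, re_trace_mul_conjTranspose_self]
  conv_rhs => rw [Finset.sum_comm (f := fun i j => ‖Z i j‖ ^ 2)]
  simp only [Matrix.trace, diag_apply, Matrix.mul_apply, ← Finset.sum_add_distrib, Finset.sum_div]
  refine (norm_sum_le _ _).trans (Finset.sum_le_sum fun i _ => ?_)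
  refine (norm_sum_le _ _).trans (Finset.sum_le_sum fun j _ => ?_)
  rw [norm_mul]
  nlinarith [sq_nonneg (‖Y i j‖ - ‖Z j i‖)]

variable [DecidableEq n]

theorem trace_mul_pow_comm (X Y : Matrix n n ℂ) (k : ℕ) :
    ((X * Y) ^ k).trace = ((Y * X) ^ k).trace := by
  rcases k with _ | k
  · simp
  · rw [pow_succ', mul_assoc, trace_mul_comm, mul_assoc, mul_pow_mul, ← mul_assoc, ← pow_succ']

theorem norm_trace_pow_two_pow_le (k : ℕ) :
    (∀ X : Matrix n n ℂ, ‖(X ^ 2 ^ (k + 1)).trace‖ ≤ ((X * Xᴴ) ^ 2 ^ k).trace.re) ∧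
    (∀ A B : Matrix n n ℂ, A.IsHermitian → B.IsHermitian →
      ((A * B) ^ 2 ^ k).trace.re ≤ (A ^ 2 ^ k * B ^ 2 ^ k).trace.re) := by
  induction k with
  | zero =>
    refine ⟨fun X => ?_, fun A B _ _ => by simp⟩
    have := norm_trace_mul_le X X
    simpa [pow_two] using this
  | succ k ih =>
    obtain ⟨hP, hQ⟩ := ih
    constructor
    · intro X
      have hA := isHermitian_conjTranspose_mul_self X
      have hB := isHermitian_mul_conjTranspose_self X
      have h1 : X ^ 2 ^ (k + 1 + 1) = (X ^ 2) ^ 2 ^ (k + 1) := by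
        rw [← pow_mul]; congr 1; ring
      have h2 : ((X ^ 2 * (X ^ 2)ᴴ) ^ 2 ^ k).trace = ((Xᴴ * X * (X * Xᴴ)) ^ 2 ^ k).trace := by
        rw [show X ^ 2 * (X ^ 2)ᴴ = X * (X * Xᴴ * Xᴴ) by
          rw [conjTranspose_pow, pow_two, pow_two]; noncomm_ring, trace_mul_pow_comm,
          show X * Xᴴ * Xᴴ * X = (X * Xᴴ) * (Xᴴ * X) by noncomm_ring, trace_mul_pow_comm]
      rw [h1]
      refine (hP _).trans ?_
      rw [h2]
      refine (hQ _ _ hA hB).trans ((Complex.re_le_norm _).trans ((norm_trace_mul_le _ _).trans ?_))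
      rw [(hA.pow _).eq, (hB.pow _).eq, ← pow_add, ← pow_add, ← two_mul, ← pow_succ',
        trace_mul_pow_comm]
      linarith
    · intro A B hA hB
      refine (Complex.re_le_norm _).trans ((hP _).trans ?_)
      have h : ((A * B * (A * B)ᴴ) ^ 2 ^ k).trace = ((A ^ 2 * B ^ 2) ^ 2 ^ k).trace := by
        rw [conjTranspose_mul, hA.eq, hB.eq, show A * B * (B * A) = A * B ^ 2 * A by
          rw [pow_two]; noncomm_ring, trace_mul_pow_comm, ← mul_assoc, ← pow_two]
      rw [h]
      refine (hQ _ _ (hA.pow 2) (hB.pow 2)).trans_eq ?_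
      rw [← pow_mul, ← pow_mul, ← pow_succ']

/-- The **Golden–Thompson inequality**. -/
theorem re_trace_exp_add_le {A B : Matrix n n ℂ} (hA : A.IsHermitian)
    (hB : B.IsHermitian) : (exp (A + B)).trace.re ≤ (exp A * exp B).trace.re := by
  have hlim : Tendsto (fun k : ℕ => (exp ((k : ℝ)⁻¹ • A) * exp ((k : ℝ)⁻¹ • B)) ^ k) atTop
      (𝓝 (exp (A + B))) := by
    cases isEmpty_or_nonempty n
    · rw [Subsingleton.elim (exp (A + B)) 0]
      exact tendsto_const_nhds.congr fun _ => Subsingleton.elim _ _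
    · open scoped Norms.Operator in exact tendsto_exp_mul_exp_pow A B
  have hcont : Continuous fun X : Matrix n n ℂ => X.trace.re := by fun_prop
  have hlim' := ((hcont.tendsto _).comp hlim).comp
    (tendsto_pow_atTop_atTop_of_one_lt (one_lt_two (α := ℕ)))
  refine le_of_tendsto hlim' (Eventually.of_forall fun k => ?_)
  have hpow (X : Matrix n n ℂ) : exp (((2 ^ k : ℕ) : ℝ)⁻¹ • X) ^ 2 ^ k = exp X := by
    rw [← exp_nsmul, ← Nat.cast_smul_eq_nsmul ℝ, smul_smul, mul_inv_cancel₀ (by positivity),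
      one_smul]
  have := (norm_trace_pow_two_pow_le (n := n) k).2 _ _ (hA.real_smul ((2 ^ k : ℕ) : ℝ)⁻¹).exp
    (hB.real_smul ((2 ^ k : ℕ) : ℝ)⁻¹).exp
  rwa [hpow, hpow] at this

theorem IsHermitian.exists_unitary_diagonalization {K : Matrix n n ℂ} (hK : K.IsHermitian) :
    ∃ U : Matrix n n ℂ, U * Uᴴ = 1 ∧ Uᴴ * U = 1 ∧
      K = U * diagonal (fun i => (hK.eigenvalues i : ℂ)) * Uᴴ ∧
      ∀ s : ℝ, NormedSpace.exp (s • K) =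
        U * diagonal (fun i => (Real.exp (s * hK.eigenvalues i) : ℂ)) * Uᴴ := by
  set U : Matrix n n ℂ := hK.eigenvectorUnitary.1
  have h1 : U * Uᴴ = 1 := Unitary.coe_mul_star_self hK.eigenvectorUnitary
  have h2 : Uᴴ * U = 1 := Unitary.coe_star_mul_self hK.eigenvectorUnitary
  have hspec : K = U * diagonal (fun i => (hK.eigenvalues i : ℂ)) * Uᴴ := hK.spectral_theorem
  refine ⟨U, h1, h2, hspec, fun s => ?_⟩
  have hinv : Uᴴ = U⁻¹ := (inv_eq_right_inv h1).symm
  have hsmul : s • K = U * diagonal (fun i => ((s * hK.eigenvalues i : ℝ) : ℂ)) * U⁻¹ := by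
    conv_lhs => rw [hspec]
    rw [hinv, ← Matrix.smul_mul, ← Matrix.mul_smul, ← diagonal_smul]
    congr 3
    ext i
    simp
  rw [hsmul, exp_conj _ _ (IsUnit.of_mul_eq_one _ h1), exp_diagonal, hinv]
  congr 3
  ext i
  rw [Pi.coe_exp, ← Complex.exp_eq_exp_ℂ, Complex.ofReal_exp]

theorem posSemidef_mul_diagonal_mul_conjTranspose (U : Matrix n n ℂ) {d : n → ℝ}
    (hd : ∀ i, 0 ≤ d i) : (U * diagonal (fun i => (d i : ℂ)) * Uᴴ).PosSemidef :=
  (PosSemidef.diagonal fun i => by simpa using hd i).mul_mul_conjTranspose_same U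

theorem IsHermitian.posSemidef_exp {K : Matrix n n ℂ} (hK : K.IsHermitian) :
    (NormedSpace.exp K).PosSemidef := by
  obtain ⟨U, -, -, -, hexp⟩ := hK.exists_unitary_diagonalization
  rw [← one_smul ℝ K, hexp]
  exact posSemidef_mul_diagonal_mul_conjTranspose U fun i => (Real.exp_pos _).le

theorem IsHermitian.re_trace_exp_mul_nonneg {H Q : Matrix n n ℂ} (hH : H.IsHermitian)
    (hQ : Q.PosSemidef) : 0 ≤ (NormedSpace.exp H * Q).trace.re := by
  have hE := (hH.real_smul (1 / 2)).exp
  have hsq : NormedSpace.exp H =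
      NormedSpace.exp ((1 / 2 : ℝ) • H) * NormedSpace.exp ((1 / 2 : ℝ) • H) := by
    rw [← exp_add_of_commute _ _ (Commute.refl _), ← add_smul]
    norm_num
  have := (hQ.conjTranspose_mul_mul_same (NormedSpace.exp ((1 / 2 : ℝ) • H))).trace_nonneg
  rw [hE.eq] at this
  rw [hsq, mul_assoc, trace_mul_comm]
  exact (Complex.le_def.1 this).1

/-- On a positive semidefinite matrix of trace at most `R`, the decreasing exponential lies below
its chord over `[0, R]`. -/
theorem PosSemidef.posSemidef_chord_sub_exp {X : Matrix n n ℂ} (hX : X.PosSemidef) {R θ : ℝ}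
    (hR : 0 < R) (htr : X.trace.re ≤ R) :
    (1 - ((1 - Real.exp (-(θ * R))) / R) • X - NormedSpace.exp (-(θ • X))).PosSemidef := by
  obtain ⟨U, h1, -, hspec, hexp⟩ := hX.1.exists_unitary_diagonalization
  set ev := hX.1.eigenvalues
  have h0 : ∀ i, 0 ≤ ev i := hX.eigenvalues_nonneg
  have hle : ∀ i, ev i ≤ R := fun i => by
    have hsum : X.trace.re = ∑ i, ev i := by
      rw [hX.1.trace_eq_sum_eigenvalues, Complex.re_sum]; rfl
    exact (Finset.single_le_sum (fun j _ => h0 j) (Finset.mem_univ i)).trans (hsum ▸ htr)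
  set c := (1 - Real.exp (-(θ * R))) / R with hc
  have hmain : 1 - c • X - NormedSpace.exp (-(θ • X)) =
      U * diagonal (fun i => ((1 - c * ev i - Real.exp (-θ * ev i) : ℝ) : ℂ)) * Uᴴ := by
    have hd : diagonal (fun i => ((1 - c * ev i - Real.exp (-θ * ev i) : ℝ) : ℂ)) =
        1 - c • diagonal (fun i => (ev i : ℂ)) -
          diagonal (fun i => (Real.exp (-θ * ev i) : ℂ)) := by
      rw [← diagonal_one, ← diagonal_smul, diagonal_sub, diagonal_sub]
      congr 1
      ext i
      simp
    rw [hd, mul_sub, mul_sub, sub_mul, sub_mul, mul_one, h1, Matrix.mul_smul, Matrix.smul_mul,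
      ← hspec, ← hexp, neg_smul]
  rw [hmain]
  refine posSemidef_mul_diagonal_mul_conjTranspose U fun i => ?_
  have hconv := convexOn_exp.2 (Set.mem_univ 0) (Set.mem_univ (-(θ * R)))
    (sub_nonneg.2 ((div_le_one hR).2 (hle i))) (div_nonneg (h0 i) hR.le) (by ring)
  simp only [smul_eq_mul, mul_zero, zero_add, Real.exp_zero, mul_one] at hconv
  have harg : ev i / R * -(θ * R) = -θ * ev i := by field_simp
  rw [harg] at hconv
  have : c * ev i = ev i / R - ev i / R * Real.exp (-(θ * R)) := by rw [hc]; ring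
  linarith

/-- The trace of the exponential dominates the exponential of every Rayleigh quotient. -/
theorem IsHermitian.exp_le_re_trace_exp {K : Matrix n n ℂ} (hK : K.IsHermitian) {c : ℝ}
    {a : n → ℂ} (ha : c * ∑ i, ‖a i‖ ^ 2 < (star a ⬝ᵥ K *ᵥ a).re) :
    Real.exp c ≤ (NormedSpace.exp K).trace.re := by
  obtain ⟨U, h1, h2, hspec, hexp⟩ := hK.exists_unitary_diagonalization
  set ev := hK.eigenvalues
  have htr : (NormedSpace.exp K).trace.re = ∑ i, Real.exp (ev i) := by
    rw [← one_smul ℝ K, hexp, trace_mul_comm, ← mul_assoc, h2, one_mul, trace_diagonal]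
    simp [-Complex.ofReal_exp]
  obtain ⟨i, hi⟩ : ∃ i, c < ev i := by
    by_contra! hall
    have hpsd := posSemidef_mul_diagonal_mul_conjTranspose U
      (d := fun i => c - ev i) fun i => sub_nonneg.2 (hall i)
    have hsub : U * diagonal (fun i => ((c - ev i : ℝ) : ℂ)) * Uᴴ = (c : ℂ) • 1 - K := by
      have hd : diagonal (fun i => ((c - ev i : ℝ) : ℂ)) =
          (c : ℂ) • 1 - diagonal (fun i => (ev i : ℂ)) := by
        rw [← diagonal_one, ← diagonal_smul, diagonal_sub]
        congr 1
        ext i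
        simp
      rw [hd, mul_sub, sub_mul, Matrix.mul_smul, mul_one, Matrix.smul_mul, h1, ← hspec]
    rw [hsub] at hpsd
    have := (Complex.le_def.1 (hpsd.dotProduct_mulVec_nonneg a)).1
    rw [sub_mulVec, dotProduct_sub, smul_mulVec, one_mulVec, dotProduct_smul] at this
    have hnorm : (star a ⬝ᵥ a) = ((∑ i, ‖a i‖ ^ 2 : ℝ) : ℂ) := by
      simp [dotProduct, ← Complex.normSq_eq_conj_mul_self, Complex.normSq_eq_norm_sq]
    rw [hnorm, smul_eq_mul, ← Complex.ofReal_mul] at this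
    simp only [Complex.zero_re, Complex.sub_re, Complex.ofReal_re] at this
    linarith
  rw [htr]
  exact (Real.exp_le_exp.2 hi.le).trans
    (Finset.single_le_sum (f := fun i => Real.exp (ev i)) (fun j _ => (Real.exp_pos _).le)
      (Finset.mem_univ i))

theorem continuous_re_trace_exp_of :
    Continuous fun g : n → n → ℂ => (NormedSpace.exp (of g)).trace.re := by
  have hexp : Continuous (NormedSpace.exp : Matrix n n ℂ → Matrix n n ℂ) := by
    open scoped Norms.Operator in exact NormedSpace.exp_continuous
  have hre : Continuous fun X : Matrix n n ℂ => X.trace.re := by fun_prop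
  exact hre.comp (hexp.comp continuous_id)

theorem measurable_re_trace_exp {Ω : Type*} [MeasurableSpace Ω] {X : Ω → Matrix n n ℂ}
    (hX : ∀ i j, Measurable fun x => X x i j) :
    Measurable fun x => (NormedSpace.exp (X x)).trace.re :=
  continuous_re_trace_exp_of.measurable.comp
    (measurable_pi_lambda _ fun i => measurable_pi_lambda _ fun j => hX i j)

section Chernoff

variable {D : Type*} [MeasurableSpace D] {μ : Measure D} [IsProbabilityMeasure μ]
  {X : D → Matrix n n ℂ} {R θ : ℝ}

theorem lintegral_re_trace_exp_sub_le (hpsd : ∀ x, (X x).PosSemidef) (hR : 0 < R)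
    (htr : ∀ x, (X x).trace.re ≤ R) (hint : ∀ i j, Integrable (fun x => X x i j) μ)
    (hmean : ∀ i j, ∫ x, X x i j ∂μ = (1 : Matrix n n ℂ) i j)
    {H : Matrix n n ℂ} (hH : H.IsHermitian) :
    ∫⁻ x, ENNReal.ofReal (NormedSpace.exp (H - θ • X x)).trace.re ∂μ ≤
      ENNReal.ofReal ((1 - (1 - Real.exp (-(θ * R))) / R) * (NormedSpace.exp H).trace.re) := by
  set c := (1 - Real.exp (-(θ * R))) / R
  set E := NormedSpace.exp H
  have hbound : ∀ x, (NormedSpace.exp (H - θ • X x)).trace.re ≤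
      E.trace.re - c * (E * X x).trace.re := fun x => by
    have hθ := ((hpsd x).1.real_smul θ).neg
    rw [sub_eq_add_neg]
    refine (re_trace_exp_add_le hH hθ).trans ?_
    have := hH.re_trace_exp_mul_nonneg ((hpsd x).posSemidef_chord_sub_exp (θ := θ) hR (htr x))
    rw [mul_sub, mul_sub, mul_one, trace_sub, trace_sub, Matrix.mul_smul, trace_smul,
      Complex.sub_re, Complex.sub_re, Complex.smul_re, smul_eq_mul] at this
    linarith
  have hnonneg : ∀ x, 0 ≤ E.trace.re - c * (E * X x).trace.re := fun x =>
    le_trans (Complex.le_def.1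
      (hH.sub ((hpsd x).1.real_smul θ)).posSemidef_exp.trace_nonneg).1 (hbound x)
  have hexpand : ∀ x, (E * X x).trace = ∑ i, ∑ j, E i j * X x j i := fun x => by
    simp [Matrix.trace, Matrix.mul_apply]
  have hterm : ∀ i j, Integrable (fun x => E i j * X x j i) μ := fun i j =>
    (hint j i).const_mul _
  have hrow : ∀ i, Integrable (fun x => ∑ j, E i j * X x j i) μ := fun i =>
    integrable_finsetSum _ fun j _ => hterm i j
  have hintE : Integrable (fun x => (E * X x).trace) μ := by
    simp_rw [hexpand]
    exact integrable_finsetSum _ fun i _ => hrow i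
  have hintRe : Integrable (fun x => (E * X x).trace.re) μ := hintE.re
  have hmeanE : ∫ x, (E * X x).trace ∂μ = E.trace := by
    simp_rw [hexpand]
    rw [integral_finsetSum _ fun i _ => hrow i]
    refine Finset.sum_congr rfl fun i _ => ?_
    rw [integral_finsetSum _ fun j _ => hterm i j]
    simp_rw [integral_const_mul, hmean]
    simp [Matrix.one_apply]
  have hmeanRe : ∫ x, (E * X x).trace.re ∂μ = E.trace.re := by
    rw [← hmeanE]; exact integral_re hintE
  calc _ ≤ ∫⁻ x, ENNReal.ofReal (E.trace.re - c * (E * X x).trace.re) ∂μ :=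
        lintegral_mono fun x => ENNReal.ofReal_le_ofReal (hbound x)
    _ = ENNReal.ofReal (∫ x, (E.trace.re - c * (E * X x).trace.re) ∂μ) :=
        (ofReal_integral_eq_lintegral_ofReal
          ((integrable_const _).sub (hintRe.const_mul c)) (ae_of_all _ hnonneg)).symm
    _ = _ := by
        rw [integral_sub (integrable_const _) (hintRe.const_mul c), integral_const_mul,
          hmeanRe, integral_const, probReal_univ, one_smul, one_sub_mul]

theorem lintegral_pi_re_trace_exp_sub_sum_le (hX : ∀ i j, Measurable fun x => X x i j)
    (hpsd : ∀ x, (X x).PosSemidef) (hR : 0 < R)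
    (htr : ∀ x, (X x).trace.re ≤ R) (hint : ∀ i j, Integrable (fun x => X x i j) μ)
    (hmean : ∀ i j, ∫ x, X x i j ∂μ = (1 : Matrix n n ℂ) i j)
    (hq : 0 ≤ 1 - (1 - Real.exp (-(θ * R))) / R) (M : ℕ)
    {H : Matrix n n ℂ} (hH : H.IsHermitian) :
    ∫⁻ xs : Fin M → D, ENNReal.ofReal (NormedSpace.exp (H - θ • ∑ i, X (xs i))).trace.re
        ∂Measure.pi (fun _ => μ) ≤
      ENNReal.ofReal ((1 - (1 - Real.exp (-(θ * R))) / R) ^ M *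
        (NormedSpace.exp H).trace.re) := by
  set q := 1 - (1 - Real.exp (-(θ * R))) / R
  induction M generalizing H with
  | zero => simp
  | succ M ih =>
    have hmeas : Measurable fun z : D × (Fin M → D) =>
        ENNReal.ofReal (NormedSpace.exp (H - θ • X z.1 - θ • ∑ i, X (z.2 i))).trace.re := by
      refine (measurable_re_trace_exp fun i j => ?_).ennreal_ofReal
      simp only [sub_apply, smul_apply, sum_apply]
      have := hX i j
      refine (measurable_const.sub ((this.comp measurable_fst).const_smul θ)).sub
        (Measurable.const_smul (Finset.measurable_sum _ fun k _ => ?_) θ)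
      exact this.comp ((measurable_pi_apply k).comp measurable_snd)
    have hmp := measurePreserving_piFinSuccAbove (fun _ : Fin (M + 1) => μ) 0
    calc _ = ∫⁻ xs : Fin (M + 1) → D, (fun z : D × (Fin M → D) =>
            ENNReal.ofReal (NormedSpace.exp (H - θ • X z.1 - θ • ∑ i, X (z.2 i))).trace.re)
            (MeasurableEquiv.piFinSuccAbove (fun _ => D) 0 xs) ∂Measure.pi (fun _ => μ) := by
          refine lintegral_congr fun xs => ?_
          simp [Fin.sum_univ_succ, sub_sub, smul_add, MeasurableEquiv.piFinSuccAbove, Fin.tail]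
      _ = ∫⁻ x, ∫⁻ ys : Fin M → D, ENNReal.ofReal
            (NormedSpace.exp (H - θ • X x - θ • ∑ i, X (ys i))).trace.re
            ∂Measure.pi (fun _ => μ) ∂μ := by
          rw [hmp.lintegral_comp hmeas, lintegral_prod _ hmeas.aemeasurable]
      _ ≤ ∫⁻ x, ENNReal.ofReal (q ^ M * (NormedSpace.exp (H - θ • X x)).trace.re) ∂μ :=
          lintegral_mono fun x => ih (hH.sub ((hpsd x).1.real_smul θ))
      _ = ENNReal.ofReal (q ^ M) *
            ∫⁻ x, ENNReal.ofReal (NormedSpace.exp (H - θ • X x)).trace.re ∂μ := by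
          simp_rw [ENNReal.ofReal_mul (pow_nonneg hq M)]
          rw [lintegral_const_mul' _ _ ENNReal.ofReal_ne_top]
      _ ≤ ENNReal.ofReal (q ^ M) * ENNReal.ofReal (q * (NormedSpace.exp H).trace.re) := by
          gcongr
          exact lintegral_re_trace_exp_sub_le hpsd hR htr hint hmean hH
      _ = _ := by
          rw [← ENNReal.ofReal_mul (pow_nonneg hq M), pow_succ, mul_assoc]

theorem measure_pi_exists_rayleigh_lt_le (hX : ∀ i j, Measurable fun x => X x i j)
    (hpsd : ∀ x, (X x).PosSemidef) (hR : 0 < R)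
    (htr : ∀ x, (X x).trace.re ≤ R) (hint : ∀ i j, Integrable (fun x => X x i j) μ)
    (hmean : ∀ i j, ∫ x, X x i j ∂μ = (1 : Matrix n n ℂ) i j) (hθ : 0 < θ)
    (hq : 0 ≤ 1 - (1 - Real.exp (-(θ * R))) / R) (M : ℕ) (c : ℝ) :
    Measure.pi (fun _ : Fin M => μ)
        {xs | ∃ a : n → ℂ, ∑ i, (star a ⬝ᵥ X (xs i) *ᵥ a).re < c * ∑ k, ‖a k‖ ^ 2} ≤
      ENNReal.ofReal (Real.exp (θ * c) *
        ((1 - (1 - Real.exp (-(θ * R))) / R) ^ M * Fintype.card n)) := by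
  set S : (Fin M → D) → Matrix n n ℂ := fun xs => (0 : Matrix n n ℂ) - θ • ∑ i, X (xs i)
  have hS : ∀ xs, (S xs).IsHermitian := fun xs =>
    isHermitian_zero.sub (IsHermitian.real_smul
      (isSelfAdjoint_sum Finset.univ fun i _ => (hpsd (xs i)).1) θ)
  have hmeas : Measurable fun xs => ENNReal.ofReal
      (Real.exp (θ * c) * (NormedSpace.exp (S xs)).trace.re) := by
    refine ((measurable_re_trace_exp fun i j => ?_).const_mul _).ennreal_ofReal
    simp only [S, sub_apply, smul_apply, sum_apply]
    exact measurable_const.sub (Measurable.const_smul (Finset.measurable_sum _ fun k _ =>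
      (hX i j).comp (measurable_pi_apply k)) θ)
  refine (meas_le_lintegral₀ hmeas.aemeasurable ?_).trans ?_
  · rintro xs ⟨a, ha⟩
    have hray : (-(θ * c)) * ∑ k, ‖a k‖ ^ 2 < (star a ⬝ᵥ S xs *ᵥ a).re := by
      have hval : (star a ⬝ᵥ S xs *ᵥ a).re = -(θ * ∑ i, (star a ⬝ᵥ X (xs i) *ᵥ a).re) := by
        simp only [S, zero_sub, neg_mulVec, smul_mulVec, dotProduct_neg, dotProduct_smul,
          sum_mulVec, dotProduct_sum, Complex.neg_re, Complex.smul_re, Complex.re_sum, smul_eq_mul]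
      rw [hval]
      nlinarith [mul_lt_mul_of_pos_left ha hθ]
    have hexp := (hS xs).exp_le_re_trace_exp hray
    rw [ENNReal.one_le_ofReal]
    calc (1 : ℝ) = Real.exp (θ * c) * Real.exp (-(θ * c)) := by rw [← Real.exp_add]; simp
      _ ≤ _ := by gcongr
  · have hmain := lintegral_pi_re_trace_exp_sub_sum_le hX hpsd hR htr hint hmean hq M
      (isHermitian_zero (n := n) (α := ℂ))
    simp_rw [ENNReal.ofReal_mul (Real.exp_pos (θ * c)).le]
    rw [lintegral_const_mul' _ _ ENNReal.ofReal_ne_top]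
    gcongr
    simpa [S, NormedSpace.exp_zero] using hmain

end Chernoff

end Matrix

theorem Real.exp_neg_lt_one_sub_add_sq_div_two {t : ℝ} (ht : 0 < t) :
    Real.exp (-t) < 1 - t + t ^ 2 / 2 := by
  have h := Real.quadratic_le_exp_of_nonneg ht.le
  have hpos : 0 < 1 - t + t ^ 2 / 2 := by nlinarith [sq_nonneg (t - 1)]
  rw [Real.exp_neg, inv_lt_iff_one_lt_mul₀ (Real.exp_pos t)]
  have hmul := mul_le_mul_of_nonneg_left h hpos.le
  nlinarith [pow_pos ht 4]

theorem chernoff_tail_lt {m M : ℕ} (hm : 0 < m) (hM0 : 0 < M) {p t : ℝ} (hp : 0 < p) (ht : 0 < t)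
    (ht1 : t < 1) (hM : 4 / t ^ 2 * m * Real.log (m / p) ≤ M) :
    Real.exp (t / (2 * m) * ((1 - t) * M)) *
      ((1 - (1 - Real.exp (-t)) / (2 * m)) ^ M * m) < p := by
  have hm' : (1 : ℝ) ≤ m := by exact_mod_cast hm
  have hM' : (0 : ℝ) < M := by exact_mod_cast hM0
  have hq : 0 ≤ 1 - (1 - Real.exp (-t)) / (2 * m) := by
    rw [sub_nonneg, div_le_one (by positivity)]
    linarith [Real.exp_pos (-t)]
  have hpow : (1 - (1 - Real.exp (-t)) / (2 * m)) ^ M ≤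
      Real.exp (M * -((1 - Real.exp (-t)) / (2 * m))) := by
    rw [Real.exp_nat_mul]
    exact pow_le_pow_left₀ hq (Real.one_sub_le_exp_neg _) M
  have hexponent : t / (2 * m) * ((1 - t) * M) + M * -((1 - Real.exp (-t)) / (2 * m)) <
      -Real.log (m / p) := by
    have h1 : t / (2 * m) * ((1 - t) * M) + M * -((1 - Real.exp (-t)) / (2 * m)) =
        M / (2 * m) * (t * (1 - t) - 1 + Real.exp (-t)) := by ring
    have h2 : M / (2 * m) * (t * (1 - t) - 1 + Real.exp (-t)) < M / (2 * m) * (-(t ^ 2 / 2)) := by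
      gcongr
      linarith [Real.exp_neg_lt_one_sub_add_sq_div_two ht]
    have h3 : Real.log (m / p) ≤ M / (2 * m) * (t ^ 2 / 2) := by
      calc Real.log (m / p) =
            (4 / t ^ 2 * m * Real.log (m / p)) * (t ^ 2 / (4 * m)) := by field_simp
        _ ≤ M * (t ^ 2 / (4 * m)) := by gcongr
        _ = _ := by ring
    linarith
  calc _ ≤ Real.exp (t / (2 * m) * ((1 - t) * M)) *
        (Real.exp (M * -((1 - Real.exp (-t)) / (2 * m))) * m) := by gcongr
    _ = Real.exp (t / (2 * m) * ((1 - t) * M) + M * -((1 - Real.exp (-t)) / (2 * m))) * m := by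
        rw [Real.exp_add]; ring
    _ < Real.exp (-Real.log (m / p)) * m := by gcongr
    _ = p := by
        rw [Real.exp_neg, Real.exp_log (by positivity)]
        field_simp

open scoped Matrix ComplexOrder in
/-- Random Marcinkiewicz–Zygmund lower bound for an orthonormal system
(Lemma `lem:aux1Finite`). -/
theorem stmt_16 (D : Type) [MeasurableSpace D] (ν : Measure D)
    [IsProbabilityMeasure ν]
    (m : ℕ) (η : Fin m → D → ℂ) (hmeas : ∀ k, Measurable (η k))
    (horth : ∀ k j, ∫ x, η k x * (starRingEnd ℂ) (η j x) ∂ν =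
      if k = j then 1 else 0)
    (φ : D → ℝ) (hφ : ∀ x, φ x = 1 / 2 + 1 / (2 * m) * ∑ k, ‖η k x‖ ^ 2)
    (μ : Measure D) [IsProbabilityMeasure μ]
    (hμ : μ = ν.withDensity fun x => ENNReal.ofReal (φ x))
    (p t : ℝ) (hp : 0 < p) (hp1 : p < 1) (ht : 0 < t) (ht1 : t < 1)
    (M : ℕ) (hM : 4 / t ^ 2 * m * Real.log (m / p) ≤ (M : ℝ)) :
    ENNReal.ofReal (1 - p) <
      Measure.pi (fun _ : Fin M => μ)
        {xs : Fin M → D | ∀ a : Fin m → ℂ,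
          (1 - t) * ∑ k, ‖a k‖ ^ 2 ≤
            (1 / M) * ∑ i, ‖∑ k, a k * η k (xs i)‖ ^ 2 / φ (xs i)} := by
  rcases Nat.eq_zero_or_pos m with rfl | hm
  · simp only [Finset.univ_eq_empty, Finset.sum_empty, norm_zero]
    simp [hp]
  have hm' : (1 : ℝ) ≤ m := by exact_mod_cast hm
  have hM0 : 0 < M := by
    have hlog : 0 < Real.log (m / p) := Real.log_pos (by rw [lt_div_iff₀ hp]; linarith)
    have : (0 : ℝ) < M := lt_of_lt_of_le (by positivity) hM
    exact_mod_cast this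
  have hM' : (0 : ℝ) < M := by exact_mod_cast hM0
  have hsum0 : ∀ x, 0 ≤ ∑ k, ‖η k x‖ ^ 2 := fun x => Finset.sum_nonneg fun k _ => sq_nonneg _
  have hφpos : ∀ x, 0 < φ x := fun x => by
    rw [hφ]
    have := hsum0 x
    positivity
  have hφmeas : Measurable φ := by
    rw [funext hφ]
    fun_prop
  have hφbound : ∀ x, (∑ k, ‖η k x‖ ^ 2) / φ x ≤ 2 * m := fun x => by
    rw [div_le_iff₀ (hφpos x), hφ x]
    field_simp
    linarith
  let X : D → Matrix (Fin m) (Fin m) ℂ := fun x =>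
    (φ x)⁻¹ • Matrix.vecMulVec (star fun k => η k x) (fun k => η k x)
  have hXapply : ∀ x i j, X x i j = (φ x)⁻¹ • (η j x * (starRingEnd ℂ) (η i x)) := fun x i j => by
    simp [X, Matrix.vecMulVec_apply, mul_comm]
  have hXmeas : ∀ i j, Measurable fun x => X x i j := fun i j => by
    simp_rw [hXapply]
    exact hφmeas.inv.smul ((hmeas j).mul (Complex.continuous_conj.measurable.comp (hmeas i)))
  have hXpsd : ∀ x, (X x).PosSemidef := fun x =>
    (Matrix.posSemidef_vecMulVec_star_self _).smul (inv_nonneg.2 (hφpos x).le)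
  have hXtr : ∀ x, (X x).trace.re ≤ 2 * m := fun x => by
    refine le_trans (le_of_eq ?_) (hφbound x)
    simp only [Matrix.trace, Matrix.diag_apply, hXapply, Complex.re_sum, Complex.smul_re,
      Complex.mul_conj, Complex.normSq_eq_norm_sq, Complex.ofReal_re, smul_eq_mul]
    rw [← Finset.mul_sum, inv_mul_eq_div]
  have hXint : ∀ i j, Integrable (fun x => X x i j) μ := fun i j => by
    refine Integrable.of_bound (hXmeas i j).aestronglyMeasurable (2 * m : ℝ)
      (ae_of_all _ fun x => le_trans ?_ (hφbound x))
    rw [hXapply, norm_smul, norm_inv, Real.norm_of_nonneg (hφpos x).le, inv_mul_eq_div, norm_mul,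
      RCLike.norm_conj]
    have hi := Finset.single_le_sum (f := fun k => ‖η k x‖ ^ 2) (fun k _ => sq_nonneg _)
      (Finset.mem_univ i)
    have hj := Finset.single_le_sum (f := fun k => ‖η k x‖ ^ 2) (fun k _ => sq_nonneg _)
      (Finset.mem_univ j)
    have := (hφpos x).le
    gcongr
    nlinarith [sq_nonneg (‖η j x‖ - ‖η i x‖)]
  have hXmean : ∀ i j, ∫ x, X x i j ∂μ = (1 : Matrix (Fin m) (Fin m) ℂ) i j := fun i j => by
    rw [hμ, integral_withDensity_eq_integral_toReal_smul hφmeas.ennreal_ofReal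
      (ae_of_all _ fun _ => ENNReal.ofReal_lt_top), Matrix.one_apply]
    simp_rw [eq_comm (a := i), ← horth j i, hXapply]
    refine integral_congr_ae (ae_of_all _ fun x => ?_)
    simp only [ENNReal.toReal_ofReal (hφpos x).le, smul_smul, mul_inv_cancel₀ (hφpos x).ne',
      one_smul]
  have hray : ∀ x (a : Fin m → ℂ),
      (star a ⬝ᵥ X x *ᵥ a).re = ‖∑ k, a k * η k x‖ ^ 2 / φ x := fun x a => by
    have hdot : (fun k => η k x) ⬝ᵥ a = ∑ k, a k * η k x := by
      simp [dotProduct, mul_comm]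
    have hstar : star a ⬝ᵥ star (fun k => η k x) = star (∑ k, a k * η k x) := by
      rw [← hdot, Matrix.star_dotProduct_star, dotProduct_comm]
    simp only [X, Matrix.smul_mulVec, dotProduct_smul, Complex.smul_re, smul_eq_mul,
      Matrix.vecMulVec_mulVec, hdot, op_smul_eq_smul, hstar]
    rw [RCLike.star_def, Complex.mul_conj, Complex.normSq_eq_norm_sq, Complex.ofReal_re,
      inv_mul_eq_div]
  have hθR : t / (2 * m) * (2 * m) = t := by field_simp
  have hbad := Matrix.measure_pi_exists_rayleigh_lt_le (θ := t / (2 * m)) hXmeas hXpsd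
    (by positivity) hXtr hXint hXmean (by positivity) (by
      rw [hθR, sub_nonneg, div_le_one (by positivity)]
      linarith [Real.exp_pos (-t)]) M ((1 - t) * M)
  rw [hθR, Fintype.card_fin] at hbad
  have hbad' := hbad.trans_lt ((ENNReal.ofReal_lt_ofReal_iff hp).2
    (chernoff_tail_lt hm hM0 hp ht ht1 hM))
  set P := Measure.pi fun _ : Fin M => μ
  set B := {xs : Fin M → D | ∃ a : Fin m → ℂ,
    ∑ i, (star a ⬝ᵥ X (xs i) *ᵥ a).re < (1 - t) * M * ∑ k, ‖a k‖ ^ 2}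
  have hcover : (1 : ENNReal) ≤ P Bᶜ + P B := by
    rw [← measure_univ (μ := P), ← Set.compl_union_self B]
    exact measure_union_le _ _
  have hgood : ENNReal.ofReal (1 - p) < P Bᶜ := by
    rw [ENNReal.ofReal_sub _ hp.le, ENNReal.ofReal_one]
    refine ENNReal.sub_lt_of_lt_add (ENNReal.ofReal_le_one.2 hp1.le) (hcover.trans_lt ?_)
    exact ENNReal.add_lt_add_left (measure_ne_top _ _) hbad'
  refine hgood.trans_le (measure_mono fun xs hxs a => ?_)
  have hxs' := not_lt.1 (not_exists.1 hxs a)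
  simp_rw [hray] at hxs'
  rw [one_div, inv_mul_eq_div, le_div_iff₀ hM']
  linarith
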